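/- Unique-minimizer lemma for attending to the last visit: let c : ℕ → ℤ satisfy c(0) = 0, c(j+1) − c(j) ∈ {−1, 1} for all j, and c(j) ≥ 0 for all j. Fix i ∈ ℕ, let ε_k = 1/(k+1), and for 0 ≤ j ≤ i define χ_j^i = ε_i ε_j (c(i+1) − c(j)) + (ε_i ε_j)²/3. Define ℓ(i+1) = max{ j ≤ i : c(j) = c(i+1) } if such j exists, and ℓ(i+1) = i otherwise. Then ℓ(i+1) is the unique minimizer of |χ_j^i| over j ∈ {0, 1, …, i}: for every j ∈ {0,…,i} with j ≠ ℓ(i+1), |χ_{ℓ(i+1)}^i| < |χ_j^i|. -/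

import Mathlib

/-- `ε_k = 1/(k+1)`. -/
def eps (k : ℕ) : ℚ := 1 / ((k : ℚ) + 1)

/-- `χ_j^i = ε_i ε_j (c(i+1) − c(j)) + (ε_i ε_j)²/3`. -/
def chi (c : ℕ → ℤ) (i j : ℕ) : ℚ :=
  eps i * eps j * ((c (i + 1) : ℚ) - (c j : ℚ)) + (eps i * eps j) ^ 2 / 3

theorem eps_pos (k : ℕ) : 0 < eps k := by
  unfold eps; positivity

theorem eps_le_one (k : ℕ) : eps k ≤ 1 := by
  unfold eps
  rw [div_le_one (by positivity)]
  linarith [(Nat.cast_nonneg k : (0 : ℚ) ≤ k)]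

theorem eps_strictAnti : StrictAnti eps := by
  intro j k h
  unfold eps
  have : (j : ℚ) < k := by exact_mod_cast h
  exact one_div_lt_one_div_of_lt (by positivity) (by linarith)

/-- A path from `0` with steps `±1` stays below any nonnegative value it has not yet attained. -/
theorem lt_of_forall_ne (c : ℕ → ℤ) (h0 : c 0 = 0)
    (hstep : ∀ j, c (j + 1) - c j = 1 ∨ c (j + 1) - c j = -1) {v : ℤ} (hv : 0 ≤ v) {i : ℕ}
    (hne : ∀ j, j ≤ i → c j ≠ v) : ∀ j, j ≤ i → c j < v := by
  intro j
  induction j with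
  | zero => intro h; have := hne 0 h; omega
  | succ j ih =>
    intro h
    have := ih (by omega)
    have := hne _ h
    have := hstep j
    omega

/-- Away from `d = 0`, an integer multiple `x * d` dominates the correction `x ^ 2 / 3`. -/
theorem two_thirds_mul_le_abs {x : ℚ} (hx : 0 < x) (hx1 : x ≤ 1) {d : ℤ} (hd : d ≠ 0) :
    2 / 3 * x ≤ |x * d + x ^ 2 / 3| := by
  rcases lt_or_gt_of_ne hd with h | h
  · have h' : (d : ℚ) ≤ -1 := by exact_mod_cast (by omega : d ≤ -1)
    rw [le_abs]
    right
    nlinarith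
  · have h' : (1 : ℚ) ≤ d := by exact_mod_cast h
    rw [le_abs]
    left
    nlinarith

/-- Unique-minimizer lemma for attending to the last visit: let `c : ℕ → ℤ` satisfy
`c(0) = 0`, `c(j+1) − c(j) ∈ {−1,1}` and `c(j) ≥ 0` for all `j`.  Fix `i` and let
`ℓ = ℓ(i+1)` be the maximal `j ≤ i` with `c(j) = c(i+1)` if one exists, and `ℓ = i`
otherwise.  Then `ℓ` is the unique minimizer of `|χ_j^i|` over `j ∈ {0,…,i}`:
for every `j ≤ i` with `j ≠ ℓ`, `|χ_ℓ^i| < |χ_j^i|`. -/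
theorem last_visit_unique_minimizer (c : ℕ → ℤ) (h0 : c 0 = 0)
    (hstep : ∀ j, c (j + 1) - c j = 1 ∨ c (j + 1) - c j = -1)
    (hnonneg : ∀ j, 0 ≤ c j) (i : ℕ) (ℓ : ℕ) (hℓi : ℓ ≤ i)
    (hmax : (∃ j, j ≤ i ∧ c j = c (i + 1)) →
      (c ℓ = c (i + 1) ∧ ∀ j, j ≤ i → c j = c (i + 1) → j ≤ ℓ))
    (hnone : (∀ j, j ≤ i → c j ≠ c (i + 1)) → ℓ = i) :
    ∀ j, j ≤ i → j ≠ ℓ → |chi c i ℓ| < |chi c i j| := by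
  intro j hj hjl
  have ha := eps_pos i
  have ha1 := eps_le_one i
  have hbj := eps_pos j
  have hbj1 := eps_le_one j
  have hbl := eps_pos ℓ
  have hbl1 := eps_le_one ℓ
  have haj : eps i ≤ eps j := eps_strictAnti.antitone hj
  have hx : 0 < eps i * eps j := mul_pos ha hbj
  have hx1 : eps i * eps j ≤ 1 := by nlinarith
  have hy : 0 < eps i * eps ℓ := mul_pos ha hbl
  by_cases hex : ∃ k, k ≤ i ∧ c k = c (i + 1)
  · obtain ⟨hcl, hlast⟩ := hmax hex
    have hl : |chi c i ℓ| = (eps i * eps ℓ) ^ 2 / 3 := by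
      unfold chi
      rw [hcl, sub_self, mul_zero, zero_add, abs_of_nonneg (by positivity)]
    rw [hl]
    by_cases hcj : c j = c (i + 1)
    · have hlt : eps i * eps ℓ < eps i * eps j :=
        mul_lt_mul_of_pos_left (eps_strictAnti (lt_of_le_of_ne (hlast j hj hcj) hjl)) ha
      unfold chi
      rw [hcj, sub_self, mul_zero, zero_add, abs_of_nonneg (by positivity)]
      gcongr
    · have key := two_thirds_mul_le_abs hx hx1 (sub_ne_zero.mpr (Ne.symm hcj))
      push_cast at key
      refine lt_of_lt_of_le ?_ key
      have h1 : (eps i * eps ℓ) ^ 2 ≤ eps i ^ 2 :=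
        pow_le_pow_left₀ hy.le (by nlinarith) 2
      nlinarith
  · have hne : ∀ k, k ≤ i → c k ≠ c (i + 1) := fun k hk h => hex ⟨k, hk, h⟩
    obtain rfl := hnone hne
    have hlt := lt_of_forall_ne c h0 hstep (hnonneg _) hne
    have hd : c (ℓ + 1) = c ℓ + 1 := by
      have := hlt ℓ le_rfl
      have := hstep ℓ
      omega
    have hxy : eps ℓ * eps ℓ < eps ℓ * eps j :=
      mul_lt_mul_of_pos_left (eps_strictAnti (lt_of_le_of_ne hj hjl)) ha
    have hdj : (1 : ℚ) ≤ (c (ℓ + 1) : ℚ) - c j := by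
      have := hlt j hj
      exact_mod_cast (by omega : 1 ≤ c (ℓ + 1) - c j)
    have hdl : (c (ℓ + 1) : ℚ) - c ℓ = 1 := by
      rw [hd]; push_cast; ring
    have hl : |chi c ℓ ℓ| = eps ℓ * eps ℓ + (eps ℓ * eps ℓ) ^ 2 / 3 := by
      unfold chi
      rw [hdl, mul_one, abs_of_nonneg (by positivity)]
    rw [hl]
    refine lt_of_lt_of_le ?_ (le_abs_self _)
    unfold chi
    have h2 : (eps ℓ * eps ℓ) ^ 2 < (eps ℓ * eps j) ^ 2 := by gcongr
    nlinarith
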